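/- Suppose v ∈ C² solves ℒ₊v = 0 on [0,∞) with v'(0) = 0 and v ≢ 0, where ℒ₊v = −v'' − (3/r)v' + v + V v + 2Q(r)∫_0^r K(r,s)Q(s)v(s)ds, V(r) = −(|x|^{-2} ∗ Q²)(r), and Q > 0 is the ground state. Then there exist δ > 0 and R > 0 such that |v(r)| ≥ c e^{δr} for all r ≥ R; in particular v ∉ L²(ℝ⁴). -/

import Mathlib

open MeasureTheory Real

noncomputable section

/-- The kernel `K(r,s) = 2π² s (1 - s²/r²)`. -/
def newtonK (r s : ℝ) : ℝ := 2 * π ^ 2 * s * (1 - s ^ 2 / r ^ 2)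

lemma aux_deriv (f : ℝ → ℝ) (hf : ContDiffOn ℝ 2 f (Set.Ici 0)) :
    ∃ f1 f2 : ℝ → ℝ, (∀ r, 0 ≤ r → HasDerivWithinAt f (f1 r) (Set.Ici 0) r) ∧
      (∀ r, 0 ≤ r → HasDerivWithinAt f1 (f2 r) (Set.Ici 0) r) ∧
      ∀ r, 0 < r → deriv f r = f1 r ∧ deriv (deriv f) r = f2 r := by
  have hu : UniqueDiffOn ℝ (Set.Ici (0:ℝ)) := uniqueDiffOn_Ici 0
  have h1 : ContDiffOn ℝ 1 (derivWithin f (Set.Ici 0)) (Set.Ici 0) :=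
    hf.derivWithin hu (by norm_num)
  have hd : ∀ r : ℝ, 0 < r → deriv f r = derivWithin f (Set.Ici 0) r := fun r hr =>
    (derivWithin_of_mem_nhds (Ici_mem_nhds hr)).symm
  refine ⟨derivWithin f (Set.Ici 0), derivWithin (derivWithin f (Set.Ici 0)) (Set.Ici 0),
    fun r hr => ?_, fun r hr => ?_, fun r hr => ⟨hd r hr, ?_⟩⟩
  · exact (hf.differentiableOn (by norm_num) r hr).hasDerivWithinAt
  · exact (h1.differentiableOn (by norm_num) r hr).hasDerivWithinAt
  · rw [derivWithin_of_mem_nhds (Ici_mem_nhds hr)]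
    apply Filter.EventuallyEq.deriv_eq
    filter_upwards [Ioi_mem_nhds hr] with x hx using hd x hx

lemma aux_V (Q V : ℝ → ℝ)
    (hQint : IntegrableOn (fun s : ℝ => Q s ^ 2 * s) (Set.Ioi 0))
    (hQL2 : IntegrableOn (fun r : ℝ => Q r ^ 2 * r ^ 3) (Set.Ioi 0))
    (hV : ∀ r : ℝ, 0 < r →
      V r = (∫ s in Set.Ioc (0:ℝ) r, newtonK r s * Q s ^ 2)
              - 2 * π ^ 2 * ∫ s in Set.Ioi (0:ℝ), Q s ^ 2 * s) :
    ∃ R : ℝ, 3 ≤ R ∧ ∀ r, R ≤ r → -(1/2) ≤ V r := by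
  set A := ∫ s in Set.Ioi (0:ℝ), Q s ^ 2 * s ^ 3 with hA
  have key : ∀ r : ℝ, 0 < r → -(2 * π ^ 2 * A) / r ^ 2 ≤ V r := by
    intro r hr
    have hi : IntegrableOn (fun s : ℝ => newtonK r s * Q s ^ 2) (Set.Ioi 0) := by
      have : IntegrableOn (fun s : ℝ => 2 * π ^ 2 * (Q s ^ 2 * s)
          - 2 * π ^ 2 / r ^ 2 * (Q s ^ 2 * s ^ 3)) (Set.Ioi 0) :=
        (hQint.const_mul _).sub (hQL2.const_mul _)
      refine this.congr_fun (fun s _ => ?_) measurableSet_Ioi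
      simp only [newtonK]; ring
    have e : ∫ s in Set.Ioi (0:ℝ), newtonK r s * Q s ^ 2
        = 2 * π ^ 2 * (∫ s in Set.Ioi (0:ℝ), Q s ^ 2 * s) - 2 * π ^ 2 / r ^ 2 * A := by
      rw [hA, ← integral_const_mul, ← integral_const_mul, ← integral_sub (hQint.const_mul _) (hQL2.const_mul _)]
      refine integral_congr_ae (Filter.Eventually.of_forall fun s => ?_)
      simp only [newtonK]; ring
    have hsplit : ∫ s in Set.Ioi (0:ℝ), newtonK r s * Q s ^ 2
        = (∫ s in Set.Ioc (0:ℝ) r, newtonK r s * Q s ^ 2)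
          + ∫ s in Set.Ioi r, newtonK r s * Q s ^ 2 := by
      rw [← Set.Ioc_union_Ioi_eq_Ioi hr.le]
      exact setIntegral_union (Set.Ioc_disjoint_Ioi le_rfl) measurableSet_Ioi
        (hi.mono_set Set.Ioc_subset_Ioi_self) (hi.mono_set (Set.Ioi_subset_Ioi hr.le))
    have hneg : ∫ s in Set.Ioi r, newtonK r s * Q s ^ 2 ≤ 0 := by
      refine setIntegral_nonpos measurableSet_Ioi fun s hs => ?_
      have hs' : r < s := hs
      have : 1 - s ^ 2 / r ^ 2 ≤ 0 := by
        rw [sub_nonpos, le_div_iff₀ (by positivity)]; nlinarith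
      have h2 : 0 ≤ 2 * π ^ 2 * s := by have := hr.trans hs'; positivity
      exact mul_nonpos_of_nonpos_of_nonneg (mul_nonpos_of_nonneg_of_nonpos h2 this) (sq_nonneg _)
    rw [hV r hr]
    have : -(2 * π ^ 2 * A) / r ^ 2 = -(2 * π ^ 2 / r ^ 2 * A) := by ring
    linarith
  have hA0 : 0 ≤ A := setIntegral_nonneg measurableSet_Ioi fun s hs => by
    have : (0:ℝ) < s := hs
    positivity
  refine ⟨3 + 4 * π ^ 2 * A, by nlinarith [sq_nonneg π, mul_nonneg (sq_nonneg π) hA0], fun r hr => ?_⟩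
  have hB : 0 ≤ π ^ 2 * A := by positivity
  have hr3 : 3 ≤ r := by linarith
  refine le_trans ?_ (key r (by linarith))
  rw [le_div_iff₀ (by positivity)]
  nlinarith

/-- derivative of the weighted Wronskian -/
lemma aux_P (Q Q1 Q2 v v1 v2 V I : ℝ → ℝ)
    (hQ1 : ∀ r, 0 ≤ r → HasDerivWithinAt Q (Q1 r) (Set.Ici 0) r)
    (hQ2 : ∀ r, 0 ≤ r → HasDerivWithinAt Q1 (Q2 r) (Set.Ici 0) r)
    (hv1 : ∀ r, 0 ≤ r → HasDerivWithinAt v (v1 r) (Set.Ici 0) r)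
    (hv2 : ∀ r, 0 ≤ r → HasDerivWithinAt v1 (v2 r) (Set.Ici 0) r)
    (hQe : ∀ r, 0 < r → r * Q2 r + 3 * Q1 r = r * (Q r + V r * Q r))
    (hve : ∀ r, 0 < r → r * v2 r + 3 * v1 r = r * (v r + V r * v r + 2 * Q r * I r)) :
    ∀ r, 0 ≤ r → HasDerivWithinAt (fun r => r ^ 3 * (v1 r * Q r - v r * Q1 r))
      (2 * r ^ 3 * Q r ^ 2 * I r) (Set.Ici 0) r := by
  intro r hr
  have h := ((hasDerivWithinAt_id r (Set.Ici 0)).pow 3).mul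
    (((hv2 r hr).mul (hQ1 r hr)).sub ((hv1 r hr).mul (hQ2 r hr)))
  refine (h.congr_deriv ?_).congr_of_eventuallyEq (Filter.Eventually.of_forall fun x => by simp) (by simp)
  rcases hr.eq_or_lt with h0 | h0
  · subst h0; simp
  · have a := hQe r h0
    have b := hve r h0
    simp
    linear_combination r ^ 2 * Q r * b - r ^ 2 * v r * a

lemma mono_of_within (f f' : ℝ → ℝ) (a b : ℝ) (ha : 0 ≤ a)
    (hf : ∀ r, 0 ≤ r → HasDerivWithinAt f (f' r) (Set.Ici 0) r)
    (hn : ∀ r, a < r → r < b → 0 ≤ f' r) : MonotoneOn f (Set.Icc a b) := by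
  refine monotoneOn_of_hasDerivWithinAt_nonneg (f' := f') (convex_Icc a b) (fun r hr => ?_) (fun r hr => ?_) (fun r hr => ?_)
  · exact ((hf r (ha.trans hr.1)).continuousWithinAt).mono (fun x hx => ha.trans hx.1)
  · rw [interior_Icc] at hr ⊢
    exact (hf r (ha.trans hr.1.le)).mono (fun x hx => ha.trans hx.1.le)
  · rw [interior_Icc] at hr
    exact hn r hr.1 hr.2

lemma aux_I_cont (Q v : ℝ → ℝ) (hQ : ContinuousOn Q (Set.Ici 0)) (hv : ContinuousOn v (Set.Ici 0))
    (r : ℝ) (hr : 0 ≤ r) :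
    ContinuousOn (fun s => newtonK r s * Q s * v s) (Set.Icc 0 r) := by
  have hsub : Set.Icc 0 r ⊆ Set.Ici 0 := fun x hx => hx.1
  have : ContinuousOn (fun s => newtonK r s) (Set.Icc 0 r) := by
    unfold newtonK; fun_prop
  exact (this.mul (hQ.mono hsub)).mul (hv.mono hsub)

lemma newtonK_nonneg (r s : ℝ) (hs : 0 ≤ s) (h : s ≤ r) : 0 ≤ newtonK r s := by
  have : s ^ 2 / r ^ 2 ≤ 1 := div_le_one_of_le₀ (by gcongr) (by positivity)
  unfold newtonK
  have : 0 ≤ 1 - s ^ 2 / r ^ 2 := by linarith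
  positivity

lemma newtonK_le (r s : ℝ) (hs : 0 ≤ s) : newtonK r s ≤ 2 * π ^ 2 * s := by
  have : 0 ≤ s ^ 2 / r ^ 2 := by positivity
  unfold newtonK
  have h2 : 0 ≤ 2 * π ^ 2 * s := by positivity
  nlinarith

lemma newtonK_pos (r s : ℝ) (hs : 0 < s) (h : s < r) : 0 < newtonK r s := by
  have : s ^ 2 / r ^ 2 < 1 := by
    rw [div_lt_one (by have := hs.trans h; positivity)]; gcongr
  unfold newtonK
  have : 0 < 1 - s ^ 2 / r ^ 2 := by linarith
  positivity

lemma w_deriv (Q Q1 v v1 : ℝ → ℝ)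
    (hQpos : ∀ r : ℝ, 0 ≤ r → 0 < Q r)
    (hQ1 : ∀ r, 0 ≤ r → HasDerivWithinAt Q (Q1 r) (Set.Ici 0) r)
    (hv1 : ∀ r, 0 ≤ r → HasDerivWithinAt v (v1 r) (Set.Ici 0) r) :
    ∀ r, 0 ≤ r → HasDerivWithinAt (fun r => v r / Q r)
      ((v1 r * Q r - v r * Q1 r) / Q r ^ 2) (Set.Ici 0) r := fun r hr =>
  (hv1 r hr).div (hQ1 r hr) (ne_of_gt (hQpos r hr))

/-- core growth, given `v 0 > 0` -/
lemma core (Q Q1 Q2 v v1 v2 V : ℝ → ℝ)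
    (hQpos : ∀ r : ℝ, 0 ≤ r → 0 < Q r)
    (hQL2 : IntegrableOn (fun r : ℝ => Q r ^ 2 * r ^ 3) (Set.Ioi 0))
    (R : ℝ) (hR3 : 3 ≤ R) (hVR : ∀ r, R ≤ r → -(1/2) ≤ V r)
    (hQ1 : ∀ r, 0 ≤ r → HasDerivWithinAt Q (Q1 r) (Set.Ici 0) r)
    (hQ2 : ∀ r, 0 ≤ r → HasDerivWithinAt Q1 (Q2 r) (Set.Ici 0) r)
    (hv1 : ∀ r, 0 ≤ r → HasDerivWithinAt v (v1 r) (Set.Ici 0) r)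
    (hv2 : ∀ r, 0 ≤ r → HasDerivWithinAt v1 (v2 r) (Set.Ici 0) r)
    (hQe : ∀ r, 0 < r → r * Q2 r + 3 * Q1 r = r * (Q r + V r * Q r))
    (hve : ∀ r, 0 < r → r * v2 r + 3 * v1 r = r * (v r + V r * v r + 2 * Q r *
      ∫ s in Set.Ioc (0:ℝ) r, newtonK r s * Q s * v s))
    (h0 : 0 < v 0) :
    ∃ δ : ℝ, 0 < δ ∧ ∃ R : ℝ, 0 < R ∧ ∃ c : ℝ, 0 < c ∧
      ∀ r : ℝ, R ≤ r → c * Real.exp (δ * r) ≤ v r := by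
  have hP := aux_P Q Q1 Q2 v v1 v2 V _ hQ1 hQ2 hv1 hv2 hQe hve
  have hw := w_deriv Q Q1 v v1 hQpos hQ1 hv1
  have hQc : ContinuousOn Q (Set.Ici 0) := fun r hr => (hQ1 r hr).continuousWithinAt
  have hvc : ContinuousOn v (Set.Ici 0) := fun r hr => (hv1 r hr).continuousWithinAt
  set I : ℝ → ℝ := fun r => ∫ s in Set.Ioc (0:ℝ) r, newtonK r s * Q s * v s with hI
  set P : ℝ → ℝ := fun r => r ^ 3 * (v1 r * Q r - v r * Q1 r) with hPdef
  have P0 : P 0 = 0 := by simp [hPdef]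
  have hInn : ∀ r, 0 ≤ r → (∀ s, 0 ≤ s → s < r → 0 < v s) → 0 ≤ I r := by
    intro r hr hpos
    have hvr : 0 ≤ v r := by
      rcases hr.eq_or_lt with h | h
      · rw [← h]; exact h0.le
      · have : r ∈ closure (Set.Ico 0 r) := by
          rw [closure_Ico h.ne]; exact ⟨hr, le_rfl⟩
        have hc : ContinuousWithinAt v (Set.Ico 0 r) r := (hvc r hr).mono fun x hx => hx.1
        have := hc.mem_closure this (t := Set.Ici 0) (fun s hs => (hpos s hs.1 hs.2).le)
        rwa [isClosed_Ici.closure_eq] at this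
    refine setIntegral_nonneg measurableSet_Ioc fun s hs => ?_
    have hvs : 0 ≤ v s := by
      rcases hs.2.eq_or_lt with h | h
      · rw [h]; exact hvr
      · exact (hpos s hs.1.le h).le
    exact mul_nonneg (mul_nonneg (newtonK_nonneg r s hs.1.le hs.2) (hQpos s hs.1.le).le) hvs
  have hvpos : ∀ r, 0 ≤ r → 0 < v r := by
    by_contra! hcon
    obtain ⟨r₁, hr₁, hvr₁⟩ := hcon
    set S : Set ℝ := Set.Ici 0 ∩ v ⁻¹' Set.Iic 0 with hS
    have hSc : IsClosed S := hvc.preimage_isClosed_of_isClosed isClosed_Ici isClosed_Iic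
    have hbdd : BddBelow S := ⟨0, fun x hx => hx.1⟩
    have hmem : sInf S ∈ S := hSc.csInf_mem ⟨r₁, hr₁, hvr₁⟩ hbdd
    set a := sInf S
    have ha0 : 0 ≤ a := hmem.1
    have hva : v a ≤ 0 := hmem.2
    have hlt : ∀ s, 0 ≤ s → s < a → 0 < v s := by
      intro s hs hsa
      by_contra! h
      exact absurd (csInf_le hbdd (show s ∈ S from ⟨hs, h⟩)) (not_le.2 hsa)
    have hPm : MonotoneOn P (Set.Icc 0 a) := mono_of_within P _ 0 a le_rfl hP fun r h1 h2 => by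
      have := hInn r h1.le (fun s hs hsr => hlt s hs (hsr.trans h2))
      positivity
    have hwm := mono_of_within _ _ 0 a le_rfl hw fun r h1 h2 => by
      have h3 : P 0 ≤ P r := hPm ⟨le_rfl, ha0⟩ ⟨h1.le, h2.le⟩ h1.le
      rw [P0] at h3
      have h4 : 0 ≤ v1 r * Q r - v r * Q1 r := by
        by_contra! h
        have : P r < 0 := mul_neg_of_pos_of_neg (by positivity) h
        linarith
      positivity
    have h5 := hwm ⟨le_rfl, ha0⟩ ⟨ha0, le_rfl⟩ ha0
    have h6 : 0 < v 0 / Q 0 := div_pos h0 (hQpos 0 le_rfl)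
    have h7 : v a / Q a ≤ 0 := div_nonpos_of_nonpos_of_nonneg hva (hQpos a ha0).le
    simp only at h5
    linarith
  have hIpos : ∀ r, 0 < r → 0 < I r := by
    intro r hr
    simp only [hI]
    rw [← intervalIntegral.integral_of_le hr.le]
    refine intervalIntegral.intervalIntegral_pos_of_pos_on ?_ ?_ hr
    · apply ContinuousOn.intervalIntegrable
      rw [Set.uIcc_of_le hr.le]
      exact aux_I_cont Q v hQc hvc r hr.le
    · intro s hs
      exact mul_pos (mul_pos (newtonK_pos r s hs.1 hs.2) (hQpos s hs.1.le)) (hvpos s hs.1.le)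
  have hP1 : 0 < P 1 := by
    have : StrictMonoOn P (Set.Icc 0 1) := by
      refine strictMonoOn_of_hasDerivWithinAt_pos (f' := fun r => 2 * r ^ 3 * Q r ^ 2 * I r)
        (convex_Icc 0 1) (fun r hr => ?_) (fun r hr => ?_) (fun r hr => ?_)
      · exact ((hP r hr.1).continuousWithinAt).mono fun x hx => hx.1
      · rw [interior_Icc] at hr ⊢
        exact (hP r hr.1.le).mono fun x hx => hx.1.le
      · rw [interior_Icc] at hr
        have h1 := hIpos r hr.1
        have h2 := hQpos r hr.1.le
        have h3 := hr.1
        positivity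
    have := this (a := 0) (b := 1) (by simp) (by simp) one_pos
    rwa [P0] at this
  have hPge : ∀ r, 1 ≤ r → P 1 ≤ P r := fun r hr =>
    mono_of_within P _ 1 r zero_le_one hP (fun x h1 _ => by
      have h1' : 0 < x := by linarith
      have := hIpos x h1'
      positivity) ⟨le_rfl, hr⟩ ⟨hr, le_rfl⟩ hr
  -- there is a point with positive derivative
  have hex : ∃ r₀, R ≤ r₀ ∧ 0 < v1 r₀ := by
    by_contra! hcon
    have hvle : ∀ r, R ≤ r → v r ≤ v R := by
      intro r hr
      have := mono_of_within (fun x => - v x) (fun x => - v1 x) R r (by linarith)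
        (fun x hx => (hv1 x hx).neg) (fun x h1 _ => by have := hcon x h1.le; simp; linarith)
        ⟨le_rfl, hr⟩ ⟨hr, le_rfl⟩ hr
      simpa using this
    have hm := hvpos R (by linarith)
    set d := P 1 / v R with hd
    have hdpos : 0 < d := div_pos hP1 hm
    have hQd : ∀ r, R ≤ r → Q1 r ≤ - d / r ^ 3 := by
      intro r hr
      have hr0 : 0 < r := by linarith
      have a1 := hPge r (by linarith)
      have a2 : P r = r ^ 3 * (v1 r * Q r) + v r * (- (r ^ 3 * Q1 r)) := by simp only [hPdef]; ring
      have a3 : r ^ 3 * (v1 r * Q r) ≤ 0 := mul_nonpos_of_nonneg_of_nonpos (by positivity)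
        (mul_nonpos_of_nonpos_of_nonneg (hcon r hr) (hQpos r hr0.le).le)
      have a4 : P 1 ≤ v r * (- (r ^ 3 * Q1 r)) := by linarith
      have a5 : 0 < - (r ^ 3 * Q1 r) := by
        by_contra! h
        have := mul_nonpos_of_nonneg_of_nonpos (hvpos r hr0.le).le h
        linarith
      have a6 : P 1 ≤ v R * (- (r ^ 3 * Q1 r)) := a4.trans
        (mul_le_mul_of_nonneg_right (hvle r hr) a5.le)
      have a7 : d ≤ - (r ^ 3 * Q1 r) := by
        rw [hd, div_le_iff₀ hm]; linarith
      rw [le_div_iff₀ (by positivity)]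
      linarith
    have hQlow : ∀ r, R ≤ r → d / (2 * r ^ 2) ≤ Q r := by
      intro r hr
      have hr0 : 0 < r := by linarith
      have hb : ∀ t, r ≤ t → d / (2 * r ^ 2) - d / (2 * t ^ 2) ≤ Q r := by
        intro t ht
        have hm : AntitoneOn (fun x => Q x - d / (2 * x ^ 2)) (Set.Ici R) := by
          refine antitoneOn_of_hasDerivWithinAt_nonpos (f' := fun x => Q1 x + d / x ^ 3)
            (convex_Ici R) (fun x hx => ?_) (fun x hx => ?_) (fun x hx => ?_)
          · have hx' : R ≤ x := hx
            have hx0 : (2 * x ^ 2) ≠ 0 := by have : 0 < x := by linarith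
                                             positivity
            refine ContinuousWithinAt.sub ?_ ?_
            · exact ((hQ1 x (by linarith)).continuousWithinAt).mono
                fun y hy => (by linarith : (0:ℝ) ≤ R).trans hy
            · exact ContinuousAt.continuousWithinAt (by fun_prop (disch := assumption))
          · rw [interior_Ici] at hx ⊢
            have hx' : R < x := hx
            have hx0 : 0 < x := by linarith
            have h1 := (hQ1 x hx0.le).mono (t := Set.Ici 0) (s := Set.Ioi R)
              fun y hy => (by linarith : (0:ℝ) ≤ R).trans (le_of_lt hy)
            have h2 : HasDerivAt (fun x : ℝ => d / (2 * x ^ 2)) (- (d / x ^ 3)) x := by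
              have := (hasDerivAt_const x d).div (((hasDerivAt_id x).pow 2).const_mul 2)
                (by simp; positivity)
              refine this.congr_deriv ?_
              simp; field_simp
            exact (h1.sub h2.hasDerivWithinAt).congr_deriv (by ring)
          · rw [interior_Ici] at hx
            have := hQd x (le_of_lt hx)
            rw [neg_div] at this
            linarith
        have := hm (show r ∈ Set.Ici R from hr) (show t ∈ Set.Ici R from hr.trans ht) ht
        simp only at this
        have := hQpos t (by linarith)
        linarith
      have hlim : Filter.Tendsto (fun t : ℝ => d / (2 * r ^ 2) - d / (2 * t ^ 2)) Filter.atTop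
          (nhds (d / (2 * r ^ 2) - 0)) := by
        refine tendsto_const_nhds.sub (Filter.Tendsto.div_atTop tendsto_const_nhds ?_)
        exact (Filter.tendsto_pow_atTop (by norm_num)).const_mul_atTop (by norm_num)
      rw [sub_zero] at hlim
      exact le_of_tendsto hlim (by filter_upwards [Filter.eventually_ge_atTop r] with t ht using hb t ht)
    apply not_integrableOn_Ioi_inv (a := R)
    have hI2 : IntegrableOn (fun r : ℝ => 4 / d ^ 2 * (Q r ^ 2 * r ^ 3)) (Set.Ioi R) :=
      (hQL2.mono_set (Set.Ioi_subset_Ioi (by linarith))).const_mul _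
    refine Integrable.mono' hI2 (by fun_prop) ?_
    refine (ae_restrict_iff' measurableSet_Ioi).2 (Filter.Eventually.of_forall fun r hr => ?_)
    have hr' : R < r := hr
    have hr0 : 0 < r := by linarith
    rw [Real.norm_eq_abs, abs_of_pos (by positivity)]
    have h1 : (d / (2 * r ^ 2)) ^ 2 ≤ Q r ^ 2 := by gcongr; exact hQlow r hr'.le
    calc r⁻¹ = 4 / d ^ 2 * ((d / (2 * r ^ 2)) ^ 2 * r ^ 3) := by field_simp; ring
      _ ≤ _ := by gcongr
  obtain ⟨r₀, hr₀, hd⟩ := hex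
  have hr00 : 0 < r₀ := by linarith
  have hvr₀ := hvpos r₀ hr00.le
  set δ := min (1/4) (v1 r₀ / v r₀) with hδ
  have hδ0 : 0 < δ := lt_min (by norm_num) (div_pos hd hvr₀)
  have hδ4 : δ ≤ 1/4 := min_le_left _ _
  have hδv : δ * v r₀ ≤ v1 r₀ := by
    rw [← le_div_iff₀ hvr₀]; exact min_le_right _ _
  have hexp : ∀ (c r : ℝ), HasDerivWithinAt (fun r => exp (c * r)) (exp (c * r) * c) (Set.Ici 0) r :=
    fun c r => by
      have := ((hasDerivAt_id r).const_mul c).exp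
      simpa using this.hasDerivWithinAt
  have hgrow : ∀ r, r₀ ≤ r → δ * v r ≤ v1 r := by
    intro r hr
    have hm := mono_of_within (fun r => exp (δ * r) * (r ^ 3 * (v1 r - δ * v r)))
      (fun r => exp (δ * r) * δ * (r ^ 3 * (v1 r - δ * v r)) + exp (δ * r) *
        (3 * r ^ 2 * (v1 r - δ * v r) + r ^ 3 * (v2 r - δ * v1 r))) r₀ r hr00.le
      (fun x hx => by
        have h := (hexp δ x).mul (((hasDerivWithinAt_id x (Set.Ici 0)).pow 3).mul
          ((hv2 x hx).sub ((hv1 x hx).const_mul δ)))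
        refine (h.congr_deriv ?_).congr_of_eventuallyEq
          (Filter.Eventually.of_forall fun x => by simp) (by simp)
        simp)
      (fun x h1 h2 => by
        have hx0 : 0 < x := by linarith
        have hvx := hvpos x hx0.le
        have hIx := hIpos x hx0
        have hQx := hQpos x hx0.le
        have hVx := hVR x (by linarith)
        have e := hve x hx0
        have e2 : exp (δ * x) * δ * (x ^ 3 * (v1 x - δ * v x)) + exp (δ * x) *
            (3 * x ^ 2 * (v1 x - δ * v x) + x ^ 3 * (v2 x - δ * v1 x))
            = exp (δ * x) * x ^ 2 * (v x * (x * (1 + V x - δ ^ 2) - 3 * δ) + 2 * x * Q x * I x) := by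
          linear_combination exp (δ * x) * x ^ 2 * e
        rw [e2]
        have e3 : 0 ≤ x * (1 + V x - δ ^ 2) - 3 * δ := by
          have : 7/16 ≤ 1 + V x - δ ^ 2 := by nlinarith
          nlinarith
        positivity)
      ⟨le_rfl, hr⟩ ⟨hr, le_rfl⟩ hr
    simp only at hm
    have s1 : 0 ≤ exp (δ * r₀) * (r₀ ^ 3 * (v1 r₀ - δ * v r₀)) := by
      have : 0 ≤ v1 r₀ - δ * v r₀ := by linarith
      positivity
    by_contra! h
    have hr0 : 0 < r := by linarith
    have : exp (δ * r) * (r ^ 3 * (v1 r - δ * v r)) < 0 :=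
      mul_neg_of_pos_of_neg (by positivity) (mul_neg_of_pos_of_neg (by positivity) (by linarith))
    linarith
  refine ⟨δ, hδ0, r₀, hr00, v r₀ * exp (-δ * r₀), by positivity, fun r hr => ?_⟩
  have hm := mono_of_within (fun r => v r * exp (-δ * r))
    (fun r => v1 r * exp (-δ * r) + v r * (exp (-δ * r) * -δ)) r₀ r hr00.le
    (fun x hx => (hv1 x hx).mul (hexp (-δ) x))
    (fun x h1 h2 => by
      have := hgrow x h1.le
      have e : v1 x * exp (-δ * x) + v x * (exp (-δ * x) * -δ)
        = exp (-δ * x) * (v1 x - δ * v x) := by ring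
      rw [e]
      have : 0 ≤ v1 x - δ * v x := by linarith
      positivity)
    ⟨le_rfl, hr⟩ ⟨hr, le_rfl⟩ hr
  simp only at hm
  calc v r₀ * exp (-δ * r₀) * exp (δ * r) ≤ v r * exp (-δ * r) * exp (δ * r) := by gcongr
    _ = v r := by rw [mul_assoc, ← exp_add]; simp

/-- uniqueness at the origin -/
lemma uniq (Q Q1 Q2 v v1 v2 V : ℝ → ℝ)
    (hQpos : ∀ r : ℝ, 0 ≤ r → 0 < Q r)
    (hQ1 : ∀ r, 0 ≤ r → HasDerivWithinAt Q (Q1 r) (Set.Ici 0) r)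
    (hQ2 : ∀ r, 0 ≤ r → HasDerivWithinAt Q1 (Q2 r) (Set.Ici 0) r)
    (hv1 : ∀ r, 0 ≤ r → HasDerivWithinAt v (v1 r) (Set.Ici 0) r)
    (hv2 : ∀ r, 0 ≤ r → HasDerivWithinAt v1 (v2 r) (Set.Ici 0) r)
    (hQe : ∀ r, 0 < r → r * Q2 r + 3 * Q1 r = r * (Q r + V r * Q r))
    (hve : ∀ r, 0 < r → r * v2 r + 3 * v1 r = r * (v r + V r * v r + 2 * Q r *
      ∫ s in Set.Ioc (0:ℝ) r, newtonK r s * Q s * v s))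
    (h0 : v 0 = 0) (T : ℝ) (hT : 0 ≤ T) : v T = 0 := by
  have hP := aux_P Q Q1 Q2 v v1 v2 V _ hQ1 hQ2 hv1 hv2 hQe hve
  have hw := w_deriv Q Q1 v v1 hQpos hQ1 hv1
  have hQc : ContinuousOn Q (Set.Ici 0) := fun r hr => (hQ1 r hr).continuousWithinAt
  have hvc : ContinuousOn v (Set.Ici 0) := fun r hr => (hv1 r hr).continuousWithinAt
  have hsub : Set.Icc 0 T ⊆ Set.Ici 0 := fun x hx => hx.1
  set I : ℝ → ℝ := fun r => ∫ s in Set.Ioc (0:ℝ) r, newtonK r s * Q s * v s with hI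
  set P : ℝ → ℝ := fun r => r ^ 3 * (v1 r * Q r - v r * Q1 r) with hPdef
  have P0 : P 0 = 0 := by simp [hPdef]
  have hne : (Set.Icc 0 T).Nonempty := ⟨0, le_rfl, hT⟩
  obtain ⟨xm, hxm, hmin⟩ := isCompact_Icc.exists_isMinOn hne (hQc.mono hsub)
  obtain ⟨xM, hxM, hmax⟩ := isCompact_Icc.exists_isMaxOn hne (hQc.mono hsub)
  set m := Q xm
  set B := Q xM
  have hm : 0 < m := hQpos _ hxm.1
  have hB : 0 < B := hQpos _ hxM.1
  have hQm : ∀ r ∈ Set.Icc 0 T, m ≤ Q r := fun r hr => hmin hr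
  have hQB : ∀ r ∈ Set.Icc 0 T, Q r ≤ B := fun r hr => hmax hr
  -- constants
  set C1 := 2 * π ^ 2 * T * B ^ 2 * T with hC1
  have hC10 : 0 ≤ C1 := by positivity
  set C := 2 * B ^ 2 * C1 * T / m ^ 2 + 1 with hC
  have hCpos : 0 < C := by positivity
  set lam := 2 * C with hlam
  have hlam0 : 0 < lam := by positivity
  have hgc : ContinuousOn (fun r => |v r / Q r| * exp (-lam * r)) (Set.Icc 0 T) := by
    refine ContinuousOn.mul ?_ (by fun_prop)
    exact (ContinuousOn.div (hvc.mono hsub) (hQc.mono hsub)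
      (fun r hr => (hQpos r hr.1).ne')).abs
  obtain ⟨xg, hxg, hg⟩ := isCompact_Icc.exists_isMaxOn hne hgc
  set M := |v xg / Q xg| * exp (-lam * xg) with hM
  have hM0 : 0 ≤ M := by positivity
  have hwM : ∀ r ∈ Set.Icc 0 T, |v r / Q r| ≤ M * exp (lam * r) := by
    intro r hr
    have : |v r / Q r| * exp (-lam * r) ≤ M := hg hr
    calc |v r / Q r| = |v r / Q r| * exp (-lam * r) * exp (lam * r) := by
          rw [mul_assoc, ← exp_add]; simp
      _ ≤ _ := by gcongr
  have hIb : ∀ r ∈ Set.Icc 0 T, |I r| ≤ C1 * (M * exp (lam * r)) := by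
    intro r hr
    have := norm_setIntegral_le_of_norm_le_const (μ := volume) (s := Set.Ioc (0:ℝ) r)
      (f := fun s => newtonK r s * Q s * v s) (C := 2 * π ^ 2 * T * B ^ 2 * (M * exp (lam * r)))
      (by simp) (fun s hs => by
        have hsT : s ∈ Set.Icc 0 T := ⟨hs.1.le, hs.2.trans hr.2⟩
        have hq := hQpos s hs.1.le
        have e : newtonK r s * Q s * v s = newtonK r s * Q s ^ 2 * (v s / Q s) := by field_simp
        rw [e, Real.norm_eq_abs, abs_mul, abs_mul, abs_of_nonneg (newtonK_nonneg r s hs.1.le hs.2),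
          abs_of_nonneg (sq_nonneg (Q s))]
        have k1 : newtonK r s ≤ 2 * π ^ 2 * T := (newtonK_le r s hs.1.le).trans (by
          have := hsT.2; gcongr)
        have k2 : |v s / Q s| ≤ M * exp (lam * r) := (hwM s hsT).trans (by have := hs.2; gcongr)
        have k3 := hQB s hsT
        gcongr)
    rw [Real.norm_eq_abs] at this
    refine this.trans ?_
    simp only [Measure.real, Real.volume_Ioc, sub_zero, ENNReal.toReal_ofReal hr.1]
    have h2 := hr.2
    have : 2 * π ^ 2 * T * B ^ 2 * (M * exp (lam * r)) * r
      ≤ 2 * π ^ 2 * T * B ^ 2 * (M * exp (lam * r)) * T := by gcongr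
    refine this.trans (le_of_eq ?_)
    rw [hC1]; ring
  have hPb : ∀ r ∈ Set.Icc 0 T, |P r| ≤ 2 * r ^ 3 * B ^ 2 * (C1 * (M * exp (lam * r))) * r := by
    intro r hr
    have := (convex_Icc 0 r).norm_image_sub_le_of_norm_hasDerivWithin_le (f := P)
      (f' := fun r => 2 * r ^ 3 * Q r ^ 2 * I r)
      (C := 2 * r ^ 3 * B ^ 2 * (C1 * (M * exp (lam * r)))) (x := 0) (y := r)
      (fun s hs => (hP s hs.1).mono fun x hx => hx.1)
      (fun s hs => by
        have hsT : s ∈ Set.Icc 0 T := ⟨hs.1, hs.2.trans hr.2⟩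
        have hq := hQpos s hs.1
        have hs0 := hs.1
        have hs2 := hs.2
        have hr0 := hr.1
        rw [Real.norm_eq_abs, abs_mul, abs_of_nonneg (by positivity)]
        have k1 : |I s| ≤ C1 * (M * exp (lam * r)) := (hIb s hsT).trans (by gcongr)
        have k3 := hQB s hsT
        gcongr)
      ⟨le_rfl, hr.1⟩ ⟨hr.1, le_rfl⟩
    rw [P0, sub_zero, sub_zero, Real.norm_eq_abs, Real.norm_eq_abs, abs_of_nonneg hr.1] at this
    exact this
  have hwb : ∀ r ∈ Set.Ioc 0 T, |(v1 r * Q r - v r * Q1 r) / Q r ^ 2| ≤ C * (M * exp (lam * r)) := by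
    intro r hr
    have hr0 := hr.1
    have hrT : r ∈ Set.Icc 0 T := ⟨hr.1.le, hr.2⟩
    have h1 := hPb r hrT
    simp only [hPdef] at h1
    rw [abs_mul, abs_of_pos (by positivity : 0 < r ^ 3)] at h1
    have h2 : |v1 r * Q r - v r * Q1 r| ≤ 2 * B ^ 2 * (C1 * (M * exp (lam * r))) * r := by
      refine le_of_mul_le_mul_left (h1.trans (le_of_eq ?_)) (by positivity : 0 < r ^ 3)
      ring
    rw [abs_div, abs_of_nonneg (sq_nonneg (Q r))]
    have h3 := hQm r hrT
    have h4 := hr.2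
    calc |v1 r * Q r - v r * Q1 r| / Q r ^ 2
        ≤ (2 * B ^ 2 * (C1 * (M * exp (lam * r))) * T) / m ^ 2 := by
          gcongr
          exact h2.trans (by gcongr)
      _ = (C - 1) * (M * exp (lam * r)) := by rw [hC]; ring
      _ ≤ C * (M * exp (lam * r)) := by gcongr; linarith
  have hexp : ∀ r : ℝ, HasDerivWithinAt (fun r => M / 2 * exp (lam * r))
      (C * (M * exp (lam * r))) (Set.Ici 0) r := fun r => by
    have := (((hasDerivAt_id r).const_mul lam).exp.const_mul (M / 2)).hasDerivWithinAt (s := Set.Ici 0)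
    refine (this.congr_deriv ?_).congr_of_eventuallyEq
      (Filter.Eventually.of_forall fun x => by simp) (by simp)
    simp [hlam]; ring
  have hw2 : ∀ r ∈ Set.Icc 0 T, |v r / Q r| ≤ M / 2 * exp (lam * r) := by
    intro r hr
    have u1 := mono_of_within _ _ 0 r le_rfl (fun x hx => (hexp x).sub (hw x hx))
      (fun x h1 h2 => by
        have := (abs_le.1 (hwb x ⟨h1, h2.le.trans hr.2⟩)).2
        linarith) ⟨le_rfl, hr.1⟩ ⟨hr.1, le_rfl⟩ hr.1
    have u2 := mono_of_within _ _ 0 r le_rfl (fun x hx => (hexp x).add (hw x hx))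
      (fun x h1 h2 => by
        have := (abs_le.1 (hwb x ⟨h1, h2.le.trans hr.2⟩)).1
        linarith) ⟨le_rfl, hr.1⟩ ⟨hr.1, le_rfl⟩ hr.1
    simp [h0] at u1 u2
    rw [abs_le]
    constructor <;> linarith
  have hMz : M = 0 := by
    have h1 := hw2 xg hxg
    have h2 : M ≤ M / 2 := by
      calc M = |v xg / Q xg| * exp (-lam * xg) := hM
        _ ≤ M / 2 * exp (lam * xg) * exp (-lam * xg) := by gcongr
        _ = M / 2 := by rw [mul_assoc, ← exp_add]; simp
    linarith
  have h1 := hwM T ⟨hT, le_rfl⟩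
  rw [hMz, zero_mul] at h1
  have h2 := abs_eq_zero.1 (le_antisymm h1 (abs_nonneg _))
  rcases div_eq_zero_iff.1 h2 with h | h
  · exact h
  · exact absurd h (ne_of_gt (hQpos T hT))

/-- Growth lemma: a nontrivial C² solution `v` of the homogeneous reduced
linearized equation `ℒ₊ v = 0` with `v'(0) = 0` grows exponentially, and in
particular is not in `L²_rad(ℝ⁴)`.  Here `V = -(|x|⁻² ∗ Q²)` expressed through
Newton's theorem, and `Q > 0` is the (profile of the) ground state. -/
theorem homogeneous_solution_grows
    (Q v V : ℝ → ℝ)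
    (hQC2 : ContDiffOn ℝ 2 Q (Set.Ici 0)) (hvC2 : ContDiffOn ℝ 2 v (Set.Ici 0))
    (hQpos : ∀ r : ℝ, 0 ≤ r → 0 < Q r)
    (hQint : IntegrableOn (fun s : ℝ => Q s ^ 2 * s) (Set.Ioi 0))
    (hQL2 : IntegrableOn (fun r : ℝ => Q r ^ 2 * r ^ 3) (Set.Ioi 0))
    (hV : ∀ r : ℝ, 0 < r →
      V r = (∫ s in Set.Ioc (0:ℝ) r, newtonK r s * Q s ^ 2)
              - 2 * π ^ 2 * ∫ s in Set.Ioi (0:ℝ), Q s ^ 2 * s)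
    (hQeq : ∀ r : ℝ, 0 < r →
      -(deriv (deriv Q) r) - (3 / r) * deriv Q r + Q r + V r * Q r = 0)
    (hveq : ∀ r : ℝ, 0 < r →
      -(deriv (deriv v) r) - (3 / r) * deriv v r + v r + V r * v r
        + 2 * Q r * (∫ s in Set.Ioc (0:ℝ) r, newtonK r s * Q s * v s) = 0)
    (hv0 : deriv v 0 = 0)
    (hvne : ∃ r : ℝ, 0 ≤ r ∧ v r ≠ 0) :
    (∃ δ : ℝ, 0 < δ ∧ ∃ R : ℝ, 0 < R ∧ ∃ c : ℝ, 0 < c ∧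
      ∀ r : ℝ, R ≤ r → c * Real.exp (δ * r) ≤ |v r|) ∧
    ¬ IntegrableOn (fun r : ℝ => v r ^ 2 * r ^ 3) (Set.Ioi 0) := by
  obtain ⟨Q1, Q2, hQ1, hQ2, hQd⟩ := aux_deriv Q hQC2
  obtain ⟨v1, v2, hv1, hv2, hvd⟩ := aux_deriv v hvC2
  obtain ⟨R, hR3, hVR⟩ := aux_V Q V hQint hQL2 hV
  have hQe : ∀ r, 0 < r → r * Q2 r + 3 * Q1 r = r * (Q r + V r * Q r) := by
    intro r hr
    have h := hQeq r hr
    rw [(hQd r hr).1, (hQd r hr).2] at h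
    have : r * (3 / r) = 3 := by field_simp
    linear_combination (-r) * h - Q1 r * this
  have hve : ∀ r, 0 < r → r * v2 r + 3 * v1 r = r * (v r + V r * v r + 2 * Q r *
      ∫ s in Set.Ioc (0:ℝ) r, newtonK r s * Q s * v s) := by
    intro r hr
    have h := hveq r hr
    rw [(hvd r hr).1, (hvd r hr).2] at h
    have : r * (3 / r) = 3 := by field_simp
    linear_combination (-r) * h - v1 r * this
  have hne : v 0 ≠ 0 := by
    intro h0
    obtain ⟨T, hT, hvT⟩ := hvne
    exact hvT (uniq Q Q1 Q2 v v1 v2 V hQpos hQ1 hQ2 hv1 hv2 hQe hve h0 T hT)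
  have main : ∃ δ : ℝ, 0 < δ ∧ ∃ R : ℝ, 0 < R ∧ ∃ c : ℝ, 0 < c ∧
      ∀ r : ℝ, R ≤ r → c * Real.exp (δ * r) ≤ |v r| := by
    rcases hne.lt_or_gt with h | h
    · obtain ⟨δ, hδ, R', hR', c, hc, H⟩ := core Q Q1 Q2 (fun r => - v r) (fun r => - v1 r)
        (fun r => - v2 r) V hQpos hQL2 R hR3 hVR hQ1 hQ2 (fun r hr => (hv1 r hr).neg)
        (fun r hr => (hv2 r hr).neg) hQe (fun r hr => by
          have e := hve r hr
          simp only [mul_neg, integral_neg]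
          linear_combination -e) (by simpa using h)
      exact ⟨δ, hδ, R', hR', c, hc, fun r hr => (H r hr).trans (neg_le_abs _)⟩
    · obtain ⟨δ, hδ, R', hR', c, hc, H⟩ := core Q Q1 Q2 v v1 v2 V hQpos hQL2 R hR3 hVR hQ1 hQ2
        hv1 hv2 hQe hve h
      exact ⟨δ, hδ, R', hR', c, hc, fun r hr => (H r hr).trans (le_abs_self _)⟩
  refine ⟨main, fun hint => ?_⟩
  obtain ⟨δ, hδ, R', hR', c, hc, H⟩ := main
  apply not_integrableOn_Ioi_inv (a := max R' 1)
  have hI2 : IntegrableOn (fun r : ℝ => 1 / c ^ 2 * (v r ^ 2 * r ^ 3)) (Set.Ioi (max R' 1)) :=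
    (hint.mono_set (Set.Ioi_subset_Ioi (hR'.le.trans (le_max_left _ _)))).const_mul _
  refine Integrable.mono' hI2 (by fun_prop) ?_
  refine (ae_restrict_iff' measurableSet_Ioi).2 (Filter.Eventually.of_forall fun r hr => ?_)
  have hr' : max R' 1 < r := hr
  have hrR : R' < r := (le_max_left _ _).trans_lt hr'
  have hr1 : 1 < r := (le_max_right _ _).trans_lt hr'
  have hr0 : 0 < r := by linarith
  rw [Real.norm_eq_abs, abs_of_pos (by positivity)]
  have h1 : c ≤ |v r| := by
    have a1 : 1 ≤ exp (δ * r) := Real.one_le_exp (by positivity)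
    have a2 := H r hrR.le
    nlinarith
  have h2 : c ^ 2 ≤ v r ^ 2 := by
    rw [← sq_abs (v r)]; gcongr
  calc r⁻¹ ≤ 1 := inv_le_one_of_one_le₀ hr1.le
    _ = 1 / c ^ 2 * (c ^ 2 * 1) := by field_simp
    _ ≤ 1 / c ^ 2 * (v r ^ 2 * r ^ 3) := by
      gcongr
      exact one_le_pow₀ hr1.le

end
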